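/- arXiv:2511.12226 — 3 statements merged into one kernel-verified Lean document; each statement's English description precedes it below -/
import Mathlib

section
/- Let g₁ be a Riemannian metric on 𝕋ⁿ, let φ : 𝕋ⁿ → ℝ be a smooth positive function with m = max φ, set g₂ = φ · g₁, and let h ∈ ℝⁿ with h ≠ 0. Assume β_{g₂}(h) = m · β_{g₁}(h). Then every Mather measure μ of g₁ with rotation vector h is also a Mather measure of g₂ with rotation vector h, and φ(x) = m for every x ∈ π(supp μ). -/
open MeasureTheory Matrix

noncomputable section

/-- The flat `n`-torus `𝕋ⁿ = ℝⁿ/ℤⁿ`. -/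
abbrev Torus (n : ℕ) := Fin n → AddCircle (1 : ℝ)

/-- The canonical projection `ℝⁿ → 𝕋ⁿ`. -/
def Torus.proj {n : ℕ} (x : Fin n → ℝ) : Torus n := fun i => (x i : AddCircle (1 : ℝ))

/-- A Riemannian metric on the torus `𝕋ⁿ`: a smooth assignment `x ↦ g_x` of a positive
definite symmetric bilinear form `g_x` on the (trivialized) tangent space `ℝⁿ`. -/
structure TorusMetric (n : ℕ) where
  val : Torus n → (Fin n → ℝ) → (Fin n → ℝ) → ℝ
  symm : ∀ x v w, val x v w = val x w v
  add_left : ∀ x v₁ v₂ w, val x (v₁ + v₂) w = val x v₁ w + val x v₂ w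
  smul_left : ∀ x (c : ℝ) v w, val x (c • v) w = c * val x v w
  posdef : ∀ x v, v ≠ 0 → 0 < val x v v
  smooth : ∀ v w, ContDiff ℝ (⊤ : ℕ∞) (fun x : Fin n → ℝ => val (Torus.proj x) v w)
  cont : Continuous (fun p : Torus n × (Fin n → ℝ) × (Fin n → ℝ) => val p.1 p.2.1 p.2.2)

/-- `ℤⁿ`-periodicity of a function on `ℝⁿ` (i.e. it descends to the torus `𝕋ⁿ`). -/
def ZPeriodic {n : ℕ} {E : Type*} (F : (Fin n → ℝ) → E) : Prop :=
  ∀ (x : Fin n → ℝ) (k : Fin n → ℤ), F (x + fun i => (k i : ℝ)) = F x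

/-- A closed Borel probability measure on `𝕋ⁿ × ℝⁿ`: it has finite first moment and
`∫ df_x(v) dμ(x,v) = 0` for every `C¹` function `f` on the torus; such an `f` is
represented by its `ℤⁿ`-periodic lift `F : ℝⁿ → ℝ`, whose differential descends to a
function `DF` on the torus. -/
def IsClosedMeasure {n : ℕ} (μ : Measure (Torus n × (Fin n → ℝ))) : Prop :=
  IsProbabilityMeasure μ ∧
  Integrable (fun p : Torus n × (Fin n → ℝ) => ‖p.2‖) μ ∧
  ∀ (F : (Fin n → ℝ) → ℝ) (DF : Torus n → (Fin n → ℝ) →L[ℝ] ℝ),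
    ContDiff ℝ 1 F → ZPeriodic F →
    (∀ x : Fin n → ℝ, DF (Torus.proj x) = fderiv ℝ F x) →
    ∫ p : Torus n × (Fin n → ℝ), DF p.1 p.2 ∂μ = 0

/-- The rotation vector (Schwartzman asymptotic cycle) `ρ(μ) = ∫ v dμ(x,v) ∈ ℝⁿ`. -/
def rotationVector {n : ℕ} (μ : Measure (Torus n × (Fin n → ℝ))) : Fin n → ℝ :=
  ∫ p : Torus n × (Fin n → ℝ), p.2 ∂μ

/-- The kinetic-energy integrand `(x,v) ↦ g_x(v,v)` of a metric `g`. -/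
def energyIntegrand {n : ℕ} (g : TorusMetric n) (p : Torus n × (Fin n → ℝ)) : ℝ :=
  g.val p.1 p.2 p.2

/-- Mather's β-function of the metric `g`:
`β_g(h) = inf { (1/2)∫ g_x(v,v) dμ : μ closed, ρ(μ) = h }` (the infimum being over
measures of finite action, the others having infinite action). -/
def beta {n : ℕ} (g : TorusMetric n) (h : Fin n → ℝ) : ℝ :=
  sInf {r : ℝ | ∃ μ : Measure (Torus n × (Fin n → ℝ)),
    IsClosedMeasure μ ∧ rotationVector μ = h ∧
    Integrable (energyIntegrand g) μ ∧
    r = (1 / 2) * ∫ p, energyIntegrand g p ∂μ}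

/-- The normalization constant
`C_{g₁}(g₂) = max_x max { g₂ₓ(v,v) : g₁ₓ(v,v) = 1 }`. -/
def normConst {n : ℕ} (g₁ g₂ : TorusMetric n) : ℝ :=
  sSup {r : ℝ | ∃ (x : Torus n) (v : Fin n → ℝ), g₁.val x v v = 1 ∧ g₂.val x v v = r}

/-- A Mather (minimizing) measure of `g` with rotation vector `h`: a closed measure with
rotation vector `h` attaining the infimum defining `β_g(h)`. -/
def IsMatherMeasure {n : ℕ} (g : TorusMetric n) (h : Fin n → ℝ)
    (μ : Measure (Torus n × (Fin n → ℝ))) : Prop :=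
  IsClosedMeasure μ ∧ rotationVector μ = h ∧ Integrable (energyIntegrand g) μ ∧
  (1 / 2) * ∫ p, energyIntegrand g p ∂μ = beta g h

/-- The (topological) support of a measure. -/
def measureSupport {α : Type*} [TopologicalSpace α] {_ : MeasurableSpace α}
    (μ : Measure α) : Set α :=
  {p | ∀ U : Set α, IsOpen U → p ∈ U → μ U ≠ 0}

end

namespace TorusMetric

variable {n : ℕ} (g : TorusMetric n)

lemma continuous_energyIntegrand : Continuous (energyIntegrand g) :=
  g.cont.comp (continuous_fst.prodMk (continuous_snd.prodMk continuous_snd))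

lemma val_smul_smul (x : Torus n) (c : ℝ) (v : Fin n → ℝ) :
    g.val x (c • v) (c • v) = c ^ 2 * g.val x v v := by
  rw [g.smul_left, g.symm, g.smul_left]
  ring

lemma val_zero_zero (x : Torus n) : g.val x 0 0 = 0 := by
  simpa using g.smul_left x 0 0 0

lemma energyIntegrand_nonneg (p : Torus n × (Fin n → ℝ)) : 0 ≤ energyIntegrand g p := by
  by_cases hv : p.2 = 0
  · simp [energyIntegrand, hv, g.val_zero_zero]
  · exact (g.posdef p.1 p.2 hv).le

/-- The length `|v|_{g_x}` of a tangent vector `(x, v)`. -/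
noncomputable def length (p : Torus n × (Fin n → ℝ)) : ℝ := √(energyIntegrand g p)

lemma continuous_length : Continuous g.length := g.continuous_energyIntegrand.sqrt

lemma length_nonneg (p : Torus n × (Fin n → ℝ)) : 0 ≤ g.length p := Real.sqrt_nonneg _

lemma length_sq (p : Torus n × (Fin n → ℝ)) : g.length p ^ 2 = energyIntegrand g p :=
  Real.sq_sqrt (g.energyIntegrand_nonneg p)

lemma length_eq_zero {p : Torus n × (Fin n → ℝ)} : g.length p = 0 ↔ p.2 = 0 := by
  constructor
  · intro h
    by_contra hv
    exact (Real.sqrt_pos.2 (g.posdef p.1 p.2 hv)).ne' h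
  · intro hv
    simp [length, energyIntegrand, hv, g.val_zero_zero]

lemma integrable_length {μ : Measure (Torus n × (Fin n → ℝ))} [IsFiniteMeasure μ]
    (hint : Integrable (energyIntegrand g) μ) : Integrable g.length μ := by
  refine ((integrable_const 1).add hint).mono' g.continuous_length.aestronglyMeasurable
    (.of_forall fun p => ?_)
  rw [Real.norm_of_nonneg (g.length_nonneg p), Pi.add_apply, ← g.length_sq]
  nlinarith [sq_nonneg (g.length p - 1)]

/-- Rescales every nonzero tangent vector to length `c`. -/
noncomputable def rescale (c : ℝ) (p : Torus n × (Fin n → ℝ)) : Torus n × (Fin n → ℝ) :=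
  (p.1, (c / g.length p) • p.2)

lemma measurable_rescale (c : ℝ) : Measurable (g.rescale c) :=
  measurable_fst.prodMk
    ((measurable_const.div g.continuous_length.measurable).smul measurable_snd)

/-- The measure obtained from `μ` by reparametrizing to constant speed `c`. -/
noncomputable def reparam (c : ℝ) (μ : Measure (Torus n × (Fin n → ℝ))) : Measure (Torus n × (Fin n → ℝ)) :=
  (μ.withDensity fun p => ENNReal.ofReal (g.length p / c)).map (g.rescale c)

lemma measurable_density (c : ℝ) :
    Measurable fun p => ENNReal.ofReal (g.length p / c) :=
  (g.continuous_length.measurable.div_const c).ennreal_ofReal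

variable {c : ℝ} {μ : Measure (Torus n × (Fin n → ℝ))}
variable {E : Type*} [NormedAddCommGroup E] [NormedSpace ℝ E]

lemma integral_reparam (hc : 0 < c) {F : Torus n × (Fin n → ℝ) → E} (hF : StronglyMeasurable F) :
    ∫ p, F p ∂g.reparam c μ = ∫ p, (g.length p / c) • F (g.rescale c p) ∂μ := by
  rw [reparam, integral_map (g.measurable_rescale c).aemeasurable hF.aestronglyMeasurable,
    integral_withDensity_eq_integral_toReal_smul (g.measurable_density c)
      (.of_forall fun _ => ENNReal.ofReal_lt_top)]
  simp only [ENNReal.toReal_ofReal (div_nonneg (g.length_nonneg _) hc.le)]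

lemma integrable_reparam (hc : 0 < c) {F : Torus n × (Fin n → ℝ) → E}
    (hF : StronglyMeasurable F) :
    Integrable F (g.reparam c μ) ↔
      Integrable (fun p => (g.length p / c) • F (g.rescale c p)) μ := by
  rw [reparam, integrable_map_measure hF.aestronglyMeasurable
      (g.measurable_rescale c).aemeasurable,
    integrable_withDensity_iff_integrable_smul' (g.measurable_density c)
      (.of_forall fun _ => ENNReal.ofReal_lt_top)]
  simp only [Function.comp_apply,
    ENNReal.toReal_ofReal (div_nonneg (g.length_nonneg _) hc.le)]

lemma div_smul_rescale_snd (hc : 0 < c) (p : Torus n × (Fin n → ℝ)) :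
    (g.length p / c) • (g.rescale c p).2 = p.2 := by
  by_cases hp : g.length p = 0
  · simp [hp, g.length_eq_zero.1 hp]
  · rw [rescale, smul_smul]
    have : g.length p / c * (c / g.length p) = 1 := by field_simp
    rw [this, one_smul]

lemma div_mul_energyIntegrand_rescale (hc : 0 < c) (p : Torus n × (Fin n → ℝ)) :
    g.length p / c * energyIntegrand g (g.rescale c p) = c * g.length p := by
  by_cases hp : g.length p = 0
  · simp [hp]
  · have : energyIntegrand g (g.rescale c p) = (c / g.length p) ^ 2 * g.length p ^ 2 := by
      rw [g.length_sq]
      exact g.val_smul_smul _ _ _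
    rw [this]
    field_simp

lemma isProbabilityMeasure_reparam (hc : 0 < c) (hint : Integrable g.length μ)
    (hcμ : ∫ p, g.length p ∂μ = c) : IsProbabilityMeasure (g.reparam c μ) := by
  constructor
  rw [reparam, Measure.map_apply (g.measurable_rescale c) MeasurableSet.univ, Set.preimage_univ,
    withDensity_apply _ MeasurableSet.univ, Measure.restrict_univ,
    ← ofReal_integral_eq_lintegral_ofReal (hint.div_const c)
      (.of_forall fun p => div_nonneg (g.length_nonneg p) hc.le),
    integral_div, hcμ, div_self hc.ne', ENNReal.ofReal_one]

end TorusMetric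

lemma Torus.isOpenQuotientMap_proj {n : ℕ} : IsOpenQuotientMap (Torus.proj (n := n)) :=
  IsOpenQuotientMap.piMap fun _ => QuotientAddGroup.isOpenQuotientMap_mk

namespace IsClosedMeasure

variable {n : ℕ} {g : TorusMetric n} {c : ℝ} {μ : Measure (Torus n × (Fin n → ℝ))}

lemma reparam (hμ : IsClosedMeasure μ) (hc : 0 < c) (hint : Integrable g.length μ)
    (hcμ : ∫ p, g.length p ∂μ = c) : IsClosedMeasure (g.reparam c μ) := by
  refine ⟨g.isProbabilityMeasure_reparam hc hint hcμ, ?_, fun F DF hF hper hDF => ?_⟩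
  · rw [g.integrable_reparam hc continuous_snd.norm.stronglyMeasurable]
    refine hμ.2.1.congr (.of_forall fun p => ?_)
    have h := congrArg norm (g.div_smul_rescale_snd hc p)
    rw [norm_smul, Real.norm_of_nonneg (div_nonneg (g.length_nonneg p) hc.le)] at h
    exact h.symm
  · have hDFc : Continuous DF := by
      rw [Torus.isOpenQuotientMap_proj.isQuotientMap.continuous_iff]
      exact (hF.continuous_fderiv one_ne_zero).congr fun x => (hDF x).symm
    have hcont : Continuous fun p : Torus n × (Fin n → ℝ) => DF p.1 p.2 :=
      (hDFc.comp continuous_fst).clm_apply continuous_snd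
    rw [g.integral_reparam hc hcont.stronglyMeasurable, ← hμ.2.2 F DF hF hper hDF]
    refine integral_congr_ae (.of_forall fun p => ?_)
    change _ • DF p.1 (g.rescale c p).2 = _
    rw [← map_smul, g.div_smul_rescale_snd hc]

end IsClosedMeasure

lemma rotationVector_reparam {n : ℕ} (g : TorusMetric n) {c : ℝ} (hc : 0 < c)
    (μ : Measure (Torus n × (Fin n → ℝ))) :
    rotationVector (g.reparam c μ) = rotationVector μ := by
  rw [rotationVector, g.integral_reparam hc continuous_snd.stronglyMeasurable, rotationVector]
  simp only [g.div_smul_rescale_snd hc]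

lemma beta_le {n : ℕ} (g : TorusMetric n) {h : Fin n → ℝ}
    {μ : Measure (Torus n × (Fin n → ℝ))} (hμ : IsClosedMeasure μ) (hrot : rotationVector μ = h)
    (hint : Integrable (energyIntegrand g) μ) :
    beta g h ≤ (1 / 2) * ∫ p, energyIntegrand g p ∂μ := by
  refine csInf_le ⟨0, ?_⟩ ⟨μ, hμ, hrot, hint, rfl⟩
  rintro r ⟨ν, -, -, -, rfl⟩
  exact mul_nonneg (by norm_num) (integral_nonneg (g.energyIntegrand_nonneg))

lemma integral_length_pos {n : ℕ} (g : TorusMetric n) {μ : Measure (Torus n × (Fin n → ℝ))}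
    (hint : Integrable g.length μ) (hrot : rotationVector μ ≠ 0) : 0 < ∫ p, g.length p ∂μ := by
  refine (integral_nonneg g.length_nonneg).lt_of_ne fun h0 => hrot ?_
  have hae := (integral_eq_zero_iff_of_nonneg g.length_nonneg hint).1 h0.symm
  exact integral_eq_zero_of_ae (hae.mono fun p hp => g.length_eq_zero.1 hp)

/-- A Mather measure with nonzero rotation vector is carried by a single energy level. -/
lemma IsMatherMeasure.ae_length_eq {n : ℕ} {g : TorusMetric n} {h : Fin n → ℝ} (hh : h ≠ 0)
    {μ : Measure (Torus n × (Fin n → ℝ))} (hμ : IsMatherMeasure g h μ) :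
    ∀ᵐ p ∂μ, g.length p = ∫ q, g.length q ∂μ := by
  obtain ⟨hcl, hrot, hint, hmin⟩ := hμ
  have := hcl.1
  have hlen := g.integrable_length hint
  have hc := integral_length_pos g hlen (hrot ▸ hh)
  set c := ∫ q, g.length q ∂μ with hcμ
  have hsm := g.continuous_energyIntegrand.stronglyMeasurable
  have hint' : Integrable (energyIntegrand g) (g.reparam c μ) := by
    rw [g.integrable_reparam hc hsm]
    simp only [smul_eq_mul, g.div_mul_energyIntegrand_rescale hc]
    exact hlen.const_mul c
  have hE : ∫ p, energyIntegrand g p ∂g.reparam c μ = c * c := by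
    rw [g.integral_reparam hc hsm]
    simp only [smul_eq_mul, g.div_mul_energyIntegrand_rescale hc]
    rw [integral_const_mul, ← hcμ]
  have hle := beta_le g (hcl.reparam hc hlen hcμ.symm)
    ((rotationVector_reparam g hc μ).trans hrot) hint'
  rw [hE, ← hmin] at hle
  have hsq : ∀ p, (g.length p - c) ^ 2 = energyIntegrand g p - 2 * c * g.length p + c ^ 2 := by
    intro p
    rw [← g.length_sq]
    ring
  have hI₁ : Integrable (fun p => energyIntegrand g p - 2 * c * g.length p) μ :=
    hint.sub (hlen.const_mul _)
  have hI : Integrable (fun p => (g.length p - c) ^ 2) μ := by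
    simp only [hsq]
    exact hI₁.add (integrable_const _)
  have hval : ∫ p, (g.length p - c) ^ 2 ∂μ = ∫ p, energyIntegrand g p ∂μ - c ^ 2 := by
    simp only [hsq]
    rw [integral_add hI₁ (integrable_const _), integral_sub hint (hlen.const_mul _),
      integral_const_mul, ← hcμ]
    simp
    ring
  have hzero : ∫ p, (g.length p - c) ^ 2 ∂μ = 0 :=
    le_antisymm (by rw [hval]; linarith) (integral_nonneg fun p => sq_nonneg _)
  filter_upwards [(integral_eq_zero_iff_of_nonneg (fun p => sq_nonneg _) hI).1 hzero] with p hp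
  exact sub_eq_zero.1 (pow_eq_zero_iff two_ne_zero |>.1 hp)

/-- Let `g₂ = φ · g₁` with `φ` smooth positive, `m = max φ`, `h ≠ 0`, and
assume `β_{g₂}(h) = m · β_{g₁}(h)`. Then every Mather measure `μ` of `g₁` with rotation
vector `h` is a Mather measure of `g₂` with rotation vector `h`, and `φ ≡ m` on
`π(supp μ)`. -/
theorem conformal_rigidity_on_support {n : ℕ} (g₁ g₂ : TorusMetric n) (φ : Torus n → ℝ)
    (hφsmooth : ContDiff ℝ (⊤ : ℕ∞) (fun x : Fin n → ℝ => φ (Torus.proj x)))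
    (hφpos : ∀ x, 0 < φ x) (m : ℝ)
    (hm_le : ∀ x, φ x ≤ m) (hm_attained : ∃ x, φ x = m)
    (hconf : ∀ x v w, g₂.val x v w = φ x * g₁.val x v w)
    (h : Fin n → ℝ) (hh : h ≠ 0)
    (heq : beta g₂ h = m * beta g₁ h)
    (μ : Measure (Torus n × (Fin n → ℝ))) (hμ : IsMatherMeasure g₁ h μ) :
    IsMatherMeasure g₂ h μ ∧ ∀ x ∈ Prod.fst '' measureSupport μ, φ x = m := by
  have hφ : Continuous φ := by
    rw [Torus.isOpenQuotientMap_proj.isQuotientMap.continuous_iff]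
    exact hφsmooth.continuous
  have hae := hμ.ae_length_eq hh
  obtain ⟨hcl, hrot, hint, hmin⟩ := hμ
  have := hcl.1
  have hc := integral_length_pos g₁ (g₁.integrable_length hint) (hrot ▸ hh)
  have hE : ∀ p, energyIntegrand g₂ p = φ p.1 * energyIntegrand g₁ p := fun p => hconf _ _ _
  have hle : ∀ p, energyIntegrand g₂ p ≤ m * energyIntegrand g₁ p := fun p => by
    rw [hE]
    exact mul_le_mul_of_nonneg_right (hm_le _) (g₁.energyIntegrand_nonneg p)
  have hint₂ : Integrable (energyIntegrand g₂) μ :=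
    (hint.const_mul m).mono' g₂.continuous_energyIntegrand.aestronglyMeasurable
      (.of_forall fun p => by
        rw [Real.norm_of_nonneg (g₂.energyIntegrand_nonneg p)]
        exact hle p)
  have hmono : ∫ p, energyIntegrand g₂ p ∂μ ≤ m * ∫ p, energyIntegrand g₁ p ∂μ := by
    rw [← integral_const_mul]
    exact integral_mono hint₂ (hint.const_mul m) hle
  have hβ := beta_le g₂ hcl hrot hint₂
  rw [heq, ← hmin] at hβ
  refine ⟨⟨hcl, hrot, hint₂, by rw [heq, ← hmin]; linarith⟩, ?_⟩
  have hzero : ∫ p, (m * energyIntegrand g₁ p - energyIntegrand g₂ p) ∂μ = 0 := by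
    rw [integral_sub (hint.const_mul m) hint₂, integral_const_mul]
    linarith
  have hφae : ∀ᵐ p ∂μ, φ p.1 = m := by
    filter_upwards [hae, (integral_eq_zero_iff_of_nonneg (fun p => sub_nonneg.2 (hle p))
      ((hint.const_mul m).sub hint₂)).1 hzero] with p hp hq
    have hpos : 0 < energyIntegrand g₁ p := by
      rw [← g₁.length_sq, hp]
      exact pow_pos hc 2
    have hq' : m * energyIntegrand g₁ p - energyIntegrand g₂ p = 0 := hq
    rw [hE] at hq'
    exact mul_right_cancel₀ hpos.ne' (sub_eq_zero.1 hq').symm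
  rintro _ ⟨p, hp, rfl⟩
  by_contra hne
  exact hp {q | φ q.1 ≠ m} (isOpen_ne.preimage (hφ.comp continuous_fst)) hne (ae_iff.1 hφae)
end

section
/- Let G be a constant positive definite symmetric 2×2 real matrix, let g₀ be the flat metric on 𝕋² given by g₀,ₓ(v,w) = ⟨Gv, w⟩, and let g = φ · g₀ where φ : 𝕋² → ℝ is smooth, positive, and normalized so that max φ = 1. If β_g(h) = β_{g₀}(h) for some h ∈ ℝ² with h ≠ 0, then φ ≡ 1 on 𝕋², i.e., g = g₀ is flat. -/
open MeasureTheory Matrix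

namespace Torus

variable {n : ℕ}

lemma isOpenQuotientMap_proj_s10 : IsOpenQuotientMap (proj : (Fin n → ℝ) → Torus n) :=
  IsOpenQuotientMap.piMap fun _ => QuotientAddGroup.isOpenQuotientMap_mk

lemma continuous_of_comp_proj {E : Type*} [TopologicalSpace E] {f : Torus n → E}
    (hf : Continuous fun x => f (proj x)) : Continuous f :=
  isOpenQuotientMap_proj_s10.continuous_comp_iff.1 hf

lemma proj_add (x y : Fin n → ℝ) : proj (x + y) = proj x + proj y := by
  ext i; simp [proj]

instance isProbabilityMeasure_volume : IsProbabilityMeasure (volume : Measure (Torus n)) :=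
  have : IsProbabilityMeasure (volume : Measure (AddCircle (1 : ℝ))) :=
    ⟨by simp [AddCircle.measure_univ]⟩
  inferInstance

lemma integrable_of_continuous {f : Torus n → ℝ} (hf : Continuous f) : Integrable f :=
  hf.integrable_of_hasCompactSupport (HasCompactSupport.of_compactSpace f)

end Torus

open Torus

/-- A `ℤⁿ`-periodic function descends to the torus. -/
lemma ZPeriodic.exists_lift {n : ℕ} {E : Type*} {F : (Fin n → ℝ) → E} (hF : ZPeriodic F) :
    ∃ f : Torus n → E, ∀ x, f (proj x) = F x := by
  refine ⟨fun p => F (Function.surjInv isOpenQuotientMap_proj_s10.surjective p), fun x => ?_⟩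
  set y := Function.surjInv isOpenQuotientMap_proj_s10.surjective (proj x)
  have hy : proj y = proj x := Function.surjInv_eq _ _
  have hk : ∀ i, ∃ k : ℤ, (k : ℝ) = y i - x i := fun i => by
    have hi : ((y i - x i : ℝ) : AddCircle (1 : ℝ)) = 0 := by
      rw [AddCircle.coe_sub, sub_eq_zero]; exact congrFun hy i
    obtain ⟨k, hk⟩ := (AddCircle.coe_eq_zero_iff (1 : ℝ)).1 hi
    exact ⟨k, by simpa using hk⟩
  choose k hk using hk
  have hyx : y = x + fun i => (k i : ℝ) := by ext i; simp [hk]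
  change F y = F x
  rw [hyx, hF]

/-- The directional derivative of a `C¹` function on the torus has zero mean. -/
lemma integral_fderiv_torus_eq_zero {n : ℕ} {F : (Fin n → ℝ) → ℝ}
    {DF : Torus n → (Fin n → ℝ) →L[ℝ] ℝ} (hF : ContDiff ℝ 1 F) (hper : ZPeriodic F)
    (hDF : ∀ x, DF (proj x) = fderiv ℝ F x) (h : Fin n → ℝ) :
    ∫ x : Torus n, DF x h = 0 := by
  obtain ⟨f, hf⟩ := hper.exists_lift
  have hf_cont : Continuous f := continuous_of_comp_proj (by simpa only [hf] using hF.continuous)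
  have hDF_cont : Continuous DF :=
    continuous_of_comp_proj (by simpa only [hDF] using hF.continuous_fderiv one_ne_zero)
  have hline : Continuous fun s : ℝ => proj (s • h) :=
    isOpenQuotientMap_proj_s10.continuous.comp (by fun_prop)
  have hjoint : Continuous fun p : ℝ × Torus n => DF (p.2 + proj (p.1 • h)) h :=
    (hDF_cont.comp (continuous_snd.add (hline.comp continuous_fst))).clm_apply continuous_const
  have hftc : ∀ x : Torus n,
      ∫ s in (0 : ℝ)..1, DF (x + proj (s • h)) h = f (x + proj h) - f x := fun x => by
    obtain ⟨x, rfl⟩ := isOpenQuotientMap_proj_s10.surjective x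
    have key := intervalIntegral.integral_eq_sub_of_hasDerivAt
      (f := fun s : ℝ => F (x + s • h)) (f' := fun s => fderiv ℝ F (x + s • h) h)
      (a := 0) (b := 1)
      (fun s _ => by
        have h1 : HasDerivAt (fun s : ℝ => x + s • h) h s := by
          simpa using ((hasDerivAt_id s).smul_const h).const_add x
        exact ((hF.differentiable one_ne_zero) _).hasFDerivAt.comp_hasDerivAt s h1)
      (((hF.continuous_fderiv one_ne_zero).comp (by fun_prop)).clm_apply
        continuous_const |>.intervalIntegrable _ _)
    simpa [← proj_add, hDF, hf] using key
  have hswap : ∫ s in (0 : ℝ)..1, ∫ x : Torus n, DF (x + proj (s • h)) h =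
      ∫ x : Torus n, ∫ s in (0 : ℝ)..1, DF (x + proj (s • h)) h := by
    apply intervalIntegral_integral_swap
    rw [← Measure.restrict_univ (μ := (volume : Measure (Torus n))), Measure.prod_restrict]
    rw [Set.uIoc_of_le zero_le_one]
    exact (hjoint.continuousOn.integrableOn_compact
      (isCompact_Icc.prod isCompact_univ)).mono_set
        (Set.prod_mono Set.Ioc_subset_Icc_self subset_rfl)
  simp_rw [hftc, fun s : ℝ => integral_add_right_eq_self (μ := (volume : Measure (Torus n)))
    (fun x => DF x h) (proj (s • h))] at hswap
  rw [integral_sub (integrable_of_continuous (by fun_prop)) (integrable_of_continuous hf_cont),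
    integral_add_right_eq_self f, sub_self] at hswap
  simpa using hswap

/-- The uniform measure on the torus, carried by the constant vector field `h`. -/
noncomputable def uniformMeasure {n : ℕ} (h : Fin n → ℝ) : Measure (Torus n × (Fin n → ℝ)) :=
  (volume : Measure (Torus n)).map fun x => (x, h)

section uniformMeasure

variable {n : ℕ} (h : Fin n → ℝ)

lemma measurableEmbedding_prodMk_const :
    MeasurableEmbedding fun x : Torus n => (x, h) := measurableEmbedding_prod_mk_right h

lemma integral_uniformMeasure {E : Type*} [NormedAddCommGroup E] [NormedSpace ℝ E]
    (f : Torus n × (Fin n → ℝ) → E) : ∫ p, f p ∂uniformMeasure h = ∫ x, f (x, h) :=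
  (measurableEmbedding_prodMk_const h).integral_map f

lemma integrable_uniformMeasure {f : Torus n × (Fin n → ℝ) → ℝ}
    (hf : Continuous fun x => f (x, h)) : Integrable f (uniformMeasure h) :=
  (measurableEmbedding_prodMk_const h).integrable_map_iff.2 (integrable_of_continuous hf)

lemma isClosedMeasure_uniformMeasure : IsClosedMeasure (uniformMeasure h) := by
  refine ⟨Measure.isProbabilityMeasure_map (by fun_prop),
    integrable_uniformMeasure h (by fun_prop), fun F DF hF hper hDF => ?_⟩
  rw [integral_uniformMeasure]
  exact integral_fderiv_torus_eq_zero hF hper hDF h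

lemma rotationVector_uniformMeasure : rotationVector (uniformMeasure h) = h := by
  simp [rotationVector, integral_uniformMeasure]

lemma integrable_energyIntegrand_uniformMeasure (g : TorusMetric n) :
    Integrable (energyIntegrand g) (uniformMeasure h) :=
  integrable_uniformMeasure h (g.cont.comp (by fun_prop : Continuous fun x => (x, h, h)))

end uniformMeasure

namespace TorusMetric

variable {n : ℕ} (g : TorusMetric n)

lemma val_self_nonneg (x : Torus n) (v : Fin n → ℝ) : 0 ≤ g.val x v v := by
  rcases eq_or_ne v 0 with rfl | hv
  · simpa using (g.smul_left x 0 0 0).ge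
  · exact (g.posdef x v hv).le

/-- Testing `β_g(h)` against the uniform measure. -/
lemma beta_le_uniform (h : Fin n → ℝ) : beta g h ≤ (1 / 2) * ∫ x : Torus n, g.val x h h := by
  refine csInf_le ⟨0, ?_⟩ ⟨uniformMeasure h, isClosedMeasure_uniformMeasure h,
    rotationVector_uniformMeasure h, integrable_energyIntegrand_uniformMeasure h g, ?_⟩
  · rintro r ⟨μ, -, -, -, rfl⟩
    exact mul_nonneg (by norm_num) (integral_nonneg fun p => g.val_self_nonneg _ _)
  · rw [integral_uniformMeasure]; rfl

/-- Jensen's inequality: the uniform measure is minimizing for a flat metric. -/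
lemma le_beta_of_flat (G : Matrix (Fin n) (Fin n) ℝ)
    (hg : ∀ x v w, g.val x v w = G.mulVec v ⬝ᵥ w) (h : Fin n → ℝ) :
    (1 / 2) * (G.mulVec h ⬝ᵥ h) ≤ beta g h := by
  refine le_csInf ⟨_, uniformMeasure h, isClosedMeasure_uniformMeasure h,
    rotationVector_uniformMeasure h, integrable_energyIntegrand_uniformMeasure h g, rfl⟩ ?_
  rintro r ⟨μ, ⟨hprob, hint, -⟩, hρ, hE, rfl⟩
  have hsnd : Integrable (fun p : Torus n × (Fin n → ℝ) => p.2) μ :=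
    (integrable_norm_iff (by fun_prop)).1 hint
  let L : (Fin n → ℝ) →L[ℝ] ℝ :=
    LinearMap.toContinuousLinearMap (dotProductBilin ℝ ℝ (G.mulVec h))
  have hL : ∀ v, L v = G.mulVec h ⬝ᵥ v := fun v => rfl
  have hLint : ∫ p, L p.2 ∂μ = G.mulVec h ⬝ᵥ h := by
    rw [L.integral_comp_comm hsnd, ← hL, ← hρ]; rfl
  have hpt : ∀ p : Torus n × (Fin n → ℝ),
      2 * L p.2 - G.mulVec h ⬝ᵥ h ≤ energyIntegrand g p := fun p => by
    have h0 := g.val_self_nonneg p.1 (p.2 - h)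
    have hs := g.symm p.1 p.2 h
    simp only [hg] at h0 hs
    simp only [energyIntegrand, hg, hL]
    simp only [mulVec_sub, sub_dotProduct, dotProduct_sub] at h0
    linarith
  have hmono := integral_mono
    (((L.integrable_comp hsnd).const_mul 2).sub (integrable_const (G.mulVec h ⬝ᵥ h))) hE hpt
  rw [integral_sub' ((L.integrable_comp hsnd).const_mul 2) (integrable_const _),
    integral_const_mul, hLint] at hmono
  simp at hmono
  linarith

end TorusMetric

/-- On `𝕋²`, if `g = φ · g₀` with `g₀` flat and `φ` smooth, positive,
with `max φ = 1`, and if `β_g(h) = β_{g₀}(h)` for some `h ≠ 0`, then `φ ≡ 1`, i.e. `g = g₀`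
is flat. -/
theorem flat_rigidity_T2 (G : Matrix (Fin 2) (Fin 2) ℝ) (hG : G.PosDef)
    (g₀ : TorusMetric 2) (hg₀ : ∀ x v w, g₀.val x v w = G.mulVec v ⬝ᵥ w)
    (g : TorusMetric 2) (φ : Torus 2 → ℝ)
    (hφsmooth : ContDiff ℝ (⊤ : ℕ∞) (fun x : Fin 2 → ℝ => φ (Torus.proj x)))
    (hφpos : ∀ x, 0 < φ x)
    (hφ_le : ∀ x, φ x ≤ 1) (hφ_attained : ∃ x, φ x = 1)
    (hconf : ∀ x v w, g.val x v w = φ x * g₀.val x v w)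
    (h : Fin 2 → ℝ) (hh : h ≠ 0) (heq : beta g h = beta g₀ h) :
    (∀ x, φ x = 1) ∧ ∀ x v w, g.val x v w = g₀.val x v w := by
  have hφ : Continuous φ := continuous_of_comp_proj hφsmooth.continuous
  have hpos : 0 < G.mulVec h ⬝ᵥ h := hg₀ 0 h h ▸ g₀.posdef 0 h hh
  have hle := (g₀.le_beta_of_flat G hg₀ h).trans (heq ▸ g.beta_le_uniform h)
  simp_rw [hconf, hg₀] at hle
  rw [integral_mul_const] at hle
  have hmean : 1 ≤ ∫ x, φ x := by nlinarith
  have hone : ∀ x, φ x = 1 := fun x => by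
    by_contra hx
    have hlt := Continuous.integral_pos_of_hasCompactSupport_nonneg_nonzero
      (μ := (volume : Measure (Torus 2))) (f := fun y => 1 - φ y) (x := x) (by fun_prop)
      (HasCompactSupport.of_compactSpace _) (fun y => sub_nonneg.2 (hφ_le y))
      (sub_ne_zero.2 (Ne.symm hx))
    rw [integral_sub (integrable_const _) (integrable_of_continuous hφ)] at hlt
    simp at hlt
    linarith
  exact ⟨hone, fun x v w => by rw [hconf, hone, one_mul]⟩
end

section
/- Let g be a Riemannian metric on 𝕋ⁿ, let λ : 𝕋ⁿ → ℝ be a smooth nonnegative function, and let h ∈ ℝⁿ. Suppose there exists a Mather measure μ of g with rotation vector h such that λ(x) = 0 for every x ∈ π(supp μ). Then β_{e^λ g}(h) = β_g(h), where e^λ g denotes the conformal metric x ↦ e^{λ(x)} g_x. -/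
open MeasureTheory Matrix

/-- In a second countable space almost every point lies in the support of a measure. -/
theorem ae_mem_measureSupport {α : Type*} [TopologicalSpace α] [SecondCountableTopology α]
    {_ : MeasurableSpace α} (μ : Measure α) : ∀ᵐ p ∂μ, p ∈ measureSupport μ := by
  refine measure_null_of_locally_null _ fun p hp => ?_
  have hp' : ∃ U : Set α, IsOpen U ∧ p ∈ U ∧ μ U = 0 := by
    by_contra! hU
    exact hp hU
  obtain ⟨U, hU, hpU, hμ⟩ := hp'
  exact ⟨U, mem_nhdsWithin_of_mem_nhds (hU.mem_nhds hpU), hμ⟩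

theorem TorusMetric.energyIntegrand_nonneg_s17 {n : ℕ} (g : TorusMetric n)
    (p : Torus n × (Fin n → ℝ)) : 0 ≤ energyIntegrand g p := by
  unfold energyIntegrand
  by_cases hv : p.2 = 0
  · have h0 := g.smul_left p.1 0 p.2 p.2
    rw [zero_smul, zero_mul] at h0
    rw [← h0, hv]
  · exact (g.posdef p.1 p.2 hv).le

theorem TorusMetric.continuous_energyIntegrand_s17 {n : ℕ} (g : TorusMetric n) :
    Continuous (energyIntegrand g) :=
  g.cont.comp (continuous_fst.prodMk (continuous_snd.prodMk continuous_snd))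

theorem beta_le_of_isClosedMeasure {n : ℕ} (g : TorusMetric n) {h : Fin n → ℝ}
    {μ : Measure (Torus n × (Fin n → ℝ))} (hμ : IsClosedMeasure μ)
    (hρ : rotationVector μ = h) (hint : Integrable (energyIntegrand g) μ) :
    beta g h ≤ (1 / 2) * ∫ p, energyIntegrand g p ∂μ := by
  refine csInf_le ⟨0, ?_⟩ ⟨μ, hμ, hρ, hint, rfl⟩
  rintro r ⟨ν, -, -, -, rfl⟩
  have := integral_nonneg_of_ae (μ := ν) (.of_forall g.energyIntegrand_nonneg_s17)
  positivity

/-- If `λ ≥ 0` is a smooth function on `𝕋ⁿ` vanishing on the projected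
support of some Mather measure of `g` with rotation vector `h`, then the conformal metric
`e^λ g` has the same β-value at `h`: `β_{e^λ g}(h) = β_g(h)`. -/
theorem beta_eq_of_conformal_vanishing_on_support {n : ℕ} (g g' : TorusMetric n)
    (lam : Torus n → ℝ)
    (hsmooth : ContDiff ℝ (⊤ : ℕ∞) (fun x : Fin n → ℝ => lam (Torus.proj x)))
    (hnonneg : ∀ x, 0 ≤ lam x)
    (hconf : ∀ x v w, g'.val x v w = Real.exp (lam x) * g.val x v w)
    (h : Fin n → ℝ)
    (hex : ∃ μ : Measure (Torus n × (Fin n → ℝ)),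
      IsMatherMeasure g h μ ∧ ∀ x ∈ Prod.fst '' measureSupport μ, lam x = 0) :
    beta g' h = beta g h := by
  obtain ⟨μ, ⟨hcl, hρ, hint, hmin⟩, hsupp⟩ := hex
  have heq : energyIntegrand g =ᵐ[μ] energyIntegrand g' := by
    filter_upwards [ae_mem_measureSupport μ] with p hp
    simp [energyIntegrand, hconf, hsupp p.1 ⟨p, hp, rfl⟩]
  have hle : ∀ p, energyIntegrand g p ≤ energyIntegrand g' p := fun p => by
    have hexp := Real.one_le_exp (hnonneg p.1)
    rw [energyIntegrand.eq_1 g', hconf]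
    exact le_mul_of_one_le_left (g.energyIntegrand_nonneg_s17 p) hexp
  have hint' : Integrable (energyIntegrand g') μ := hint.congr heq
  apply le_antisymm
  · rw [← hmin, integral_congr_ae heq]
    exact beta_le_of_isClosedMeasure g' hcl hρ hint'
  · refine le_csInf ⟨_, μ, hcl, hρ, hint', rfl⟩ ?_
    rintro r ⟨ν, hν, hνρ, hνint, rfl⟩
    have hνint' : Integrable (energyIntegrand g) ν :=
      hνint.mono' g.continuous_energyIntegrand_s17.aestronglyMeasurable
        (.of_forall fun p => by
          rw [Real.norm_of_nonneg (g.energyIntegrand_nonneg_s17 p)]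
          exact hle p)
    have := integral_mono hνint' hνint hle
    linarith [beta_le_of_isClosedMeasure g hν hνρ hνint']
end
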